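/- Let n ≥ 1, m ≥ 0, l ≥ 1, and let N be a connected open neighborhood of 0 in ℂ^m × ℂ^l such that (t,0) ∈ N whenever (t,y) ∈ N. Let A, W : N → M_n(ℂ) be holomorphic, let Res_∞ ∈ M_n(ℂ) be a constant matrix, and let U_0 be a holomorphic M_n(ℂ)-valued function of t defined for (t,0) ∈ N. Define C_i := ∂A/∂t_i, F_α := ∂A/∂y_α, V := Res_∞ − W, and U(t,y) := U_0(t) − (W(t,y) − W(t,0)) + [Res_∞, A(t,y) − A(t,0)] − (A(t,y) − A(t,0)). Assume: (a) on all of N, [C_i,F_α] = 0, [F_α,U] = 0 and ∂W/∂y_α = [W,F_α] for all i,α; (b) at y = 0, [C_i,C_j] = 0, [C_i,U] = 0, ∂U/∂t_i = [V,C_i] − C_i and ∂W/∂t_i = [W,C_i] for all i,j; (c) the generation condition holds for the matrices C_1(0),…,C_m(0), U(0) ∈ M_n(ℂ) (values at the origin) with some vector ζ ∈ ℂ^n. Then on a neighborhood of 0 the full system holds: [C_i,C_j]=0, [C_i,F_α]=0, [F_α,F_β]=0, ∂C_i/∂t_j=∂C_j/∂t_i, ∂C_i/∂y_α=∂F_α/∂t_i,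 ∂F_α/∂y_β=∂F_β/∂y_α, [C_i,U]=0, [F_α,U]=0, ∂U/∂t_i=[V,C_i]−C_i, ∂U/∂y_α=[V,F_α]−F_α, ∂W/∂t_i=[W,C_i], ∂W/∂y_α=[W,F_α], ∂V/∂t_i=−[W,C_i], ∂V/∂y_α=−[W,F_α]. -/

import Mathlib

/-!
Statement 4 (Remark 2.10, Sabbah's reduction): the reduced set of equations,
together with the generation condition at the origin, implies the full
flatness system (2.16)–(2.29) near the origin.
-/

noncomputable section

/-- `n × n` complex matrices. -/
abbrev Mat (n : ℕ) := Matrix (Fin n) (Fin n) ℂ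

/-- The commutator `[A,B] = A*B - B*A`. -/
def matComm {n : ℕ} (A B : Mat n) : Mat n := A * B - B * A

/-- Entrywise holomorphy of a matrix-valued map on a set. -/
def MDiffOn {E : Type*} [NormedAddCommGroup E] [NormedSpace ℂ E] {n : ℕ}
    (f : E → Mat n) (s : Set E) : Prop :=
  ∀ k j, DifferentiableOn ℂ (fun q => f q k j) s

/-- Entrywise partial derivative of a matrix-valued map at `p` in direction `v`. -/
def mpderiv {E : Type*} [NormedAddCommGroup E] [NormedSpace ℂ E] {n : ℕ}
    (f : E → Mat n) (p v : E) : Mat n :=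
  Matrix.of fun k j => fderiv ℂ (fun q => f q k j) p v

/-- Generation condition: `ζ` together with all vectors obtained from `ζ` by finitely
many successive applications of the matrices `B i` spans `ℂ^n`. -/
def GenCond {n r : ℕ} (B : Fin r → Mat n) (ζ : Fin n → ℂ) : Prop :=
  Submodule.span ℂ
    {v : Fin n → ℂ | ∃ L : List (Fin r), v = Matrix.mulVec (L.map B).prod ζ} = ⊤

/-- Points of `ℂ^m × ℂ^l` with coordinates `(t, y)`. -/
abbrev Pt (m l : ℕ) := (Fin m → ℂ) × (Fin l → ℂ)

/-- The full flatness system (2.16)–(2.29) at a point `p`. -/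
def FullSystemAt {n m l : ℕ}
    (C : Fin m → Pt m l → Mat n) (F : Fin l → Pt m l → Mat n)
    (U V W : Pt m l → Mat n) (p : Pt m l) : Prop :=
  (∀ i j, matComm (C i p) (C j p) = 0) ∧
  (∀ i α, matComm (C i p) (F α p) = 0) ∧
  (∀ α β, matComm (F α p) (F β p) = 0) ∧
  (∀ i j, mpderiv (C i) p (Pi.single j 1, 0) = mpderiv (C j) p (Pi.single i 1, 0)) ∧
  (∀ i α, mpderiv (C i) p (0, Pi.single α 1) = mpderiv (F α) p (Pi.single i 1, 0)) ∧
  (∀ α β, mpderiv (F α) p (0, Pi.single β 1) = mpderiv (F β) p (0, Pi.single α 1)) ∧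
  (∀ i, matComm (C i p) (U p) = 0) ∧
  (∀ α, matComm (F α p) (U p) = 0) ∧
  (∀ i, mpderiv U p (Pi.single i 1, 0) = matComm (V p) (C i p) - C i p) ∧
  (∀ α, mpderiv U p (0, Pi.single α 1) = matComm (V p) (F α p) - F α p) ∧
  (∀ i, mpderiv W p (Pi.single i 1, 0) = matComm (W p) (C i p)) ∧
  (∀ α, mpderiv W p (0, Pi.single α 1) = matComm (W p) (F α p)) ∧
  (∀ i, mpderiv V p (Pi.single i 1, 0) = - matComm (W p) (C i p)) ∧
  (∀ α, mpderiv V p (0, Pi.single α 1) = - matComm (W p) (F α p))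

section SeveralVariables

open Metric Set MeasureTheory

variable {E F : Type*} [NormedAddCommGroup E] [NormedSpace ℂ E]
  [NormedAddCommGroup F] [NormedSpace ℂ F] {f : E → F} {s : Set E} {p : E}

/-- The derivative of a holomorphic map is locally bounded. -/
theorem exists_norm_fderiv_le_of_holomorphic (hs : IsOpen s) (hf : DifferentiableOn ℂ f s)
    (hp : p ∈ s) :
    ∃ r > 0, ∃ M, ball p r ⊆ s ∧ ∀ q ∈ ball p r, ‖fderiv ℂ f q‖ ≤ M := by
  have hc : ContinuousAt f p := (hf.differentiableAt (hs.mem_nhds hp)).continuousAt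
  obtain ⟨R, hR, hRs⟩ := Metric.mem_nhds_iff.1
    (Filter.inter_mem (hs.mem_nhds hp) (hc (ball_mem_nhds (f p) one_pos)))
  refine ⟨R / 2, by positivity, 2 / (R / 2),
    fun x hx => (hRs (ball_subset_ball (by linarith) hx)).1, fun q hq => ?_⟩
  have hsub : ball q (R / 2) ⊆ ball p R := ball_subset_ball' (by
    rw [mem_ball] at hq; linarith)
  refine Complex.norm_fderiv_le_div_of_mapsTo_ball
    (hf.mono fun x hx => (hRs (hsub hx)).1) (fun x hx => ?_) (by positivity)
  have h1 := (hRs (hsub hx)).2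
  have h2 := (hRs (hsub (mem_ball_self (by positivity)))).2
  simp only [mem_preimage, mem_ball] at h1 h2
  rw [mem_closedBall]
  linarith [dist_triangle_right (f x) (f q) (f p)]

/-- The derivative of a holomorphic map is continuous. -/
theorem continuousOn_fderiv_of_holomorphic (hs : IsOpen s) (hf : DifferentiableOn ℂ f s) :
    ContinuousOn (fderiv ℂ f) s := by
  intro p hp
  obtain ⟨r, hr, M, hrs, hM⟩ := exists_norm_fderiv_le_of_holomorphic hs hf hp
  refine ContinuousAt.continuousWithinAt ?_
  have hd : ∀ x ∈ ball p r, DifferentiableAt ℂ f x := fun x hx =>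
    hf.differentiableAt (hs.mem_nhds (hrs hx))
  have key : ∀ q ∈ ball p (r / 2),
      dist (fderiv ℂ f q) (fderiv ℂ f p) ≤ 2 * M / (r / 2) * dist q p := by
    intro q hq
    have hmem : ∀ x ∈ ball p (r / 2), x + (q - p) ∈ ball p r := by
      intro x hx
      rw [mem_ball, dist_eq_norm] at hx hq ⊢
      calc ‖x + (q - p) - p‖ = ‖(x - p) + (q - p)‖ := by congr 1; abel
        _ ≤ ‖x - p‖ + ‖q - p‖ := norm_add_le _ _
        _ < r := by linarith
    have hg : ∀ x ∈ ball p (r / 2), HasFDerivAt (fun x => f (x + (q - p)) - f x)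
        (fderiv ℂ f (x + (q - p)) - fderiv ℂ f x) x := by
      intro x hx
      exact ((hasFDerivAt_comp_add_right (q - p)).2 (hd _ (hmem x hx)).hasFDerivAt).sub
        (hd x (ball_subset_ball (by linarith) hx)).hasFDerivAt
    have hbd : ∀ x ∈ ball p (r / 2), ‖f (x + (q - p)) - f x‖ ≤ M * ‖q - p‖ := by
      intro x hx
      simpa using (convex_ball p r).norm_image_sub_le_of_norm_fderiv_le (𝕜 := ℂ) hd hM
        (ball_subset_ball (by linarith) hx) (hmem x hx)
    have hp' : p ∈ ball p (r / 2) := mem_ball_self (by positivity)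
    have := Complex.norm_fderiv_le_div_of_mapsTo_ball (R₂ := 2 * M * ‖q - p‖)
      (fun x hx => (hg x hx).differentiableAt.differentiableWithinAt) (fun x hx => by
        rw [mem_closedBall, dist_eq_norm]
        refine (norm_sub_le _ _).trans ?_
        linarith [hbd x hx, hbd p hp']) (by positivity : 0 < r / 2)
    rw [(hg p hp').fderiv] at this
    rw [dist_eq_norm, dist_eq_norm]
    convert this using 1
    · simp
    · ring
  refine tendsto_iff_dist_tendsto_zero.2 (squeeze_zero' (Filter.Eventually.of_forall
    fun _ => dist_nonneg) ?_ (?_ : Filter.Tendsto (fun q => 2 * M / (r / 2) * dist q p) _ _))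
  · filter_upwards [ball_mem_nhds p (by positivity : 0 < r / 2)] using key
  · have : Continuous fun q : E => 2 * M / (r / 2) * dist q p := by fun_prop
    simpa using this.tendsto p

/-- The directional derivatives of a holomorphic map are holomorphic. -/
theorem differentiableOn_fderiv_apply_of_holomorphic [CompleteSpace F] (hs : IsOpen s)
    (hf : DifferentiableOn ℂ f s) (v : E) :
    DifferentiableOn ℂ (fun q => fderiv ℂ f q v) s := by
  intro p hp
  refine DifferentiableAt.differentiableWithinAt ?_
  obtain ⟨r, hr, M, hrs, hM⟩ := exists_norm_fderiv_le_of_holomorphic hs hf hp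
  have hd : ∀ x ∈ ball p r, DifferentiableAt ℂ f x := fun x hx =>
    hf.differentiableAt (hs.mem_nhds (hrs hx))
  obtain ⟨δ, hδ, hδv⟩ : ∃ δ : ℝ, 0 < δ ∧ δ * ‖v‖ < r / 2 := by
    refine ⟨r / 2 / (‖v‖ + 1), by positivity, ?_⟩
    rw [div_mul_eq_mul_div, div_lt_iff₀ (by positivity)]
    nlinarith [norm_nonneg v]
  have hmem : ∀ x ∈ ball p (r / 2), ∀ z ∈ closedBall (0 : ℂ) δ, x + z • v ∈ ball p r := by
    intro x hx z hz
    rw [mem_ball, dist_eq_norm] at hx ⊢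
    rw [mem_closedBall_zero_iff] at hz
    calc ‖x + z • v - p‖ = ‖(x - p) + z • v‖ := by congr 1; abel
      _ ≤ ‖x - p‖ + ‖z‖ * ‖v‖ := by rw [← norm_smul]; exact norm_add_le _ _
      _ < r := by nlinarith [mul_le_mul_of_nonneg_right hz (norm_nonneg v)]
  have hcauchy : ∀ x ∈ ball p (r / 2), fderiv ℂ f x v =
      (2 * Real.pi * Complex.I : ℂ)⁻¹ • ∮ z in C(0, δ), ((z - 0) ^ 2)⁻¹ • f (x + z • v) := by
    intro x hx
    have hline : ∀ z : ℂ, x + z • v ∈ ball p r →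
        HasDerivAt (fun z : ℂ => f (x + z • v)) (fderiv ℂ f (x + z • v) v) z := by
      intro z hz
      have h2 : HasDerivAt (fun z : ℂ => x + z • v) v z := by
        simpa using ((hasDerivAt_id z).smul_const v).const_add x
      exact (hd _ hz).hasFDerivAt.comp_hasDerivAt z h2
    have hopen : IsOpen ((fun z : ℂ => x + z • v) ⁻¹' ball p r) :=
      isOpen_ball.preimage (by fun_prop)
    rw [Complex.two_pi_I_inv_smul_circleIntegral_sub_sq_inv_smul_of_differentiable hopen
      (fun z hz => hmem x hx z hz)
      (fun z hz => (hline z hz).differentiableAt.differentiableWithinAt) (mem_ball_self hδ),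
      (hline 0 (hmem x hx 0 (by simp [hδ.le]))).deriv]
    simp
  have hcircle : ∀ θ, circleMap 0 δ θ ∈ closedBall (0 : ℂ) δ := fun θ =>
    circleMap_mem_closedBall 0 hδ.le θ
  have hne : ∀ θ, (circleMap 0 δ θ - 0) ^ 2 ≠ 0 := fun θ => by
    rw [sub_zero]; exact pow_ne_zero 2 (circleMap_ne_center hδ.ne')
  have hcoef : Continuous fun θ => deriv (circleMap 0 δ) θ * ((circleMap 0 δ θ - 0) ^ 2)⁻¹ := by
    have : Continuous fun θ => ((circleMap 0 δ θ - 0) ^ 2)⁻¹ :=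
      Continuous.inv₀ (by fun_prop) hne
    simp only [deriv_circleMap]
    fun_prop
  have hpath : ∀ x, Continuous fun θ => x + circleMap 0 δ θ • v := fun x => by fun_prop
  have hFc : ∀ x ∈ ball p (r / 2), Continuous fun θ =>
      (deriv (circleMap 0 δ) θ * ((circleMap 0 δ θ - 0) ^ 2)⁻¹) •
        f (x + circleMap 0 δ θ • v) := fun x hx => hcoef.smul
    ((hf.continuousOn.mono hrs).comp_continuous (hpath x) fun θ => hmem x hx _ (hcircle θ))
  have hF'c : ∀ x ∈ ball p (r / 2), Continuous fun θ =>
      (deriv (circleMap 0 δ) θ * ((circleMap 0 δ θ - 0) ^ 2)⁻¹) •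
        fderiv ℂ f (x + circleMap 0 δ θ • v) := fun x hx => hcoef.smul
    (((continuousOn_fderiv_of_holomorphic hs hf).mono hrs).comp_continuous (hpath x)
      fun θ => hmem x hx _ (hcircle θ))
  have hball : ball p (r / 2) ∈ nhds p := ball_mem_nhds p (by positivity)
  have hp' : p ∈ ball p (r / 2) := mem_ball_self (by positivity)
  have hint := intervalIntegral.hasFDerivAt_integral_of_dominated_of_fderiv_le (𝕜 := ℂ)
    (μ := volume) (a := 0) (b := 2 * Real.pi) (x₀ := p)
    (F := fun x θ => (deriv (circleMap 0 δ) θ * ((circleMap 0 δ θ - 0) ^ 2)⁻¹) •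
        f (x + circleMap 0 δ θ • v))
    (F' := fun x θ => (deriv (circleMap 0 δ) θ * ((circleMap 0 δ θ - 0) ^ 2)⁻¹) •
        fderiv ℂ f (x + circleMap 0 δ θ • v))
    (bound := fun θ => ‖deriv (circleMap 0 δ) θ * ((circleMap 0 δ θ - 0) ^ 2)⁻¹‖ * M)
    hball
    (by filter_upwards [hball] with x hx using (hFc x hx).aestronglyMeasurable)
    ((hFc p hp').intervalIntegrable _ _) (hF'c p hp').aestronglyMeasurable
    (Filter.Eventually.of_forall fun θ _ x hx => by
      rw [norm_smul]
      exact mul_le_mul_of_nonneg_left (hM _ (hmem x hx _ (hcircle θ))) (norm_nonneg _))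
    ((hcoef.norm.mul continuous_const).intervalIntegrable _ _)
    (Filter.Eventually.of_forall fun θ _ x hx =>
      ((hasFDerivAt_comp_add_right _).2
        (hd _ (hmem x hx _ (hcircle θ))).hasFDerivAt).const_smul _)
  refine ((hint.differentiableAt.const_smul
    (2 * Real.pi * Complex.I : ℂ)⁻¹).congr_of_eventuallyEq ?_)
  filter_upwards [hball] with x hx
  rw [hcauchy x hx]
  simp only [circleIntegral, smul_smul, Pi.smul_apply]

/-- A holomorphic map on an open subset of a finite-dimensional space is smooth. -/
theorem contDiffOn_of_holomorphic [FiniteDimensional ℂ E]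
    [CompleteSpace F] (hs : IsOpen s) (hf : DifferentiableOn ℂ f s) (k : ℕ) :
    ContDiffOn ℂ k f s := by
  induction k generalizing f with
  | zero => exact contDiffOn_zero.2 hf.continuousOn
  | succ k ih =>
    push_cast
    exact (contDiffOn_succ_iff_fderiv_of_isOpen hs).2 ⟨hf, by simp,
      contDiffOn_clm_apply.2 fun v => ih (differentiableOn_fderiv_apply_of_holomorphic hs hf v)⟩

/-- Mixed second derivatives of a holomorphic map agree. -/
theorem fderiv_fderiv_comm_of_holomorphic [FiniteDimensional ℂ E]
    [CompleteSpace F] (hs : IsOpen s) (hf : DifferentiableOn ℂ f s) (hp : p ∈ s) (v w : E) :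
    fderiv ℂ (fun q => fderiv ℂ f q v) p w = fderiv ℂ (fun q => fderiv ℂ f q w) p v := by
  have hc := (contDiffOn_of_holomorphic hs hf 2).contDiffAt (hs.mem_nhds hp)
  have hd : DifferentiableAt ℂ (fderiv ℂ f) p :=
    (hc.fderiv_right (m := 1) (by norm_num)).differentiableAt one_ne_zero
  have hsymm := hc.isSymmSndFDerivAt (by simp) w v
  simpa [fderiv_clm_apply hd (differentiableAt_const _)] using hsymm

end SeveralVariables

section Flatness

open Metric Set

variable {T Y R : Type*} [NormedAddCommGroup T] [NormedSpace ℂ T]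
  [NormedAddCommGroup Y] [NormedSpace ℂ Y]

/-- A holomorphic map on a ball of a product which vanishes for `y = 0` and whose `y`-derivative is
dominated by the map itself vanishes identically. -/
theorem eq_zero_of_norm_fderiv_le_mul_norm [NormedAddCommGroup R] [NormedSpace ℂ R]
    {r : ℝ} {H : T × Y → R} {a : T × Y → ℝ}
    (hH : DifferentiableOn ℂ H (ball 0 r)) (ha : ContinuousOn a (ball 0 r))
    (hbound : ∀ p ∈ ball (0 : T × Y) r, ∀ w : Y, ‖fderiv ℂ H p (0, w)‖ ≤ a p * ‖w‖ * ‖H p‖)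
    (h0 : ∀ t : T, (t, 0) ∈ ball (0 : T × Y) r → H (t, 0) = 0) :
    ∀ p ∈ ball (0 : T × Y) r, H p = 0 := by
  rintro ⟨t, y⟩ hp
  have hmem : ∀ s ∈ Icc (0 : ℝ) 1, (t, (s : ℂ) • y) ∈ ball (0 : T × Y) r := by
    intro s hs
    rw [mem_ball_zero_iff] at hp ⊢
    refine lt_of_le_of_lt ?_ hp
    simp only [Prod.norm_def, norm_smul, Complex.norm_real, Real.norm_eq_abs, abs_of_nonneg hs.1]
    exact max_le_max le_rfl (mul_le_of_le_one_left (norm_nonneg _) hs.2)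
  have hpath : Continuous fun s : ℝ => (t, (s : ℂ) • y) := by fun_prop
  obtain ⟨K, hK⟩ := isCompact_Icc.exists_bound_of_continuousOn
    (ha.comp hpath.continuousOn hmem)
  have hder : ∀ s ∈ Icc (0 : ℝ) 1, HasDerivAt (fun s : ℝ => H (t, (s : ℂ) • y))
      (fderiv ℂ H (t, (s : ℂ) • y) (0, y)) s := by
    intro s hs
    have h1 : HasDerivAt (fun z : ℂ => (t, z • y)) (0, y) (s : ℂ) := by
      simpa using (hasDerivAt_const (s : ℂ) t).prodMk ((hasDerivAt_id (s : ℂ)).smul_const y)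
    have h2 : HasDerivAt (fun z : ℂ => H (t, z • y)) (fderiv ℂ H (t, (s : ℂ) • y) (0, y)) (s : ℂ) :=
      HasFDerivAt.comp_hasDerivAt (s : ℂ)
        (hH.differentiableAt (isOpen_ball.mem_nhds (hmem s hs))).hasFDerivAt h1
    simpa [Function.comp_def] using h2.scomp s Complex.ofRealCLM.hasDerivAt
  have := eq_zero_of_abs_deriv_le_mul_abs_self_of_eq_zero_right (K := K * ‖y‖)
    (fun s hs => (hder s hs).continuousAt.continuousWithinAt)
    (fun s hs => (hder s (Ico_subset_Icc_self hs)).hasDerivWithinAt)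
    (by simpa using h0 t (by simpa using hmem 0 (by simp)))
    (fun s hs => (hbound _ (hmem s (Ico_subset_Icc_self hs)) y).trans (by
      have := (le_abs_self _).trans (hK s (Ico_subset_Icc_self hs))
      gcongr
      exact this)) 1 (by simp)
  simpa using this

variable [NormedRing R] [NormedAlgebra ℂ R]

theorem fderiv_commutator_apply {E : Type*} [NormedAddCommGroup E] [NormedSpace ℂ E]
    {a b : E → R} {p : E} (ha : DifferentiableAt ℂ a p) (hb : DifferentiableAt ℂ b p) (v : E) :
    fderiv ℂ (fun q => a q * b q - b q * a q) p v =
      fderiv ℂ a p v * b p + a p * fderiv ℂ b p v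
        - (fderiv ℂ b p v * a p + b p * fderiv ℂ a p v) := by
  rw [((ha.hasFDerivAt.fun_mul' hb.hasFDerivAt).fun_sub (hb.hasFDerivAt.fun_mul' ha.hasFDerivAt)).fderiv]
  simp [add_comm]

variable [CompleteSpace R] [FiniteDimensional ℂ T] [FiniteDimensional ℂ Y]
  {r : ℝ} {A W U : T × Y → R}

/-- If the `t`-derivatives of `A` commute with its `y`-derivatives, then the commutator of two
`t`-derivatives vanishes as soon as it does for `y = 0`. -/
theorem commutator_fderiv_eq_zero (hA : DifferentiableOn ℂ A (ball 0 r)) (u u' : T)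
    (hCF : ∀ p ∈ ball (0 : T × Y) r, ∀ w : Y,
      fderiv ℂ A p (u, 0) * fderiv ℂ A p (0, w) - fderiv ℂ A p (0, w) * fderiv ℂ A p (u, 0) = 0)
    (hCF' : ∀ p ∈ ball (0 : T × Y) r, ∀ w : Y,
      fderiv ℂ A p (u', 0) * fderiv ℂ A p (0, w) -
        fderiv ℂ A p (0, w) * fderiv ℂ A p (u', 0) = 0)
    (h0 : ∀ t : T, (t, 0) ∈ ball (0 : T × Y) r →
      fderiv ℂ A (t, 0) (u, 0) * fderiv ℂ A (t, 0) (u', 0) -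
        fderiv ℂ A (t, 0) (u', 0) * fderiv ℂ A (t, 0) (u, 0) = 0) :
    ∀ p ∈ ball (0 : T × Y) r,
      fderiv ℂ A p (u, 0) * fderiv ℂ A p (u', 0) -
        fderiv ℂ A p (u', 0) * fderiv ℂ A p (u, 0) = 0 := by
  have hd := fun v => differentiableOn_fderiv_apply_of_holomorphic isOpen_ball hA v
  refine eq_zero_of_norm_fderiv_le_mul_norm (a := fun _ => 0)
    (((hd _).mul (hd _)).sub ((hd _).mul (hd _))) continuousOn_const (fun p hp w => ?_) h0
  have hp' := isOpen_ball.mem_nhds hp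
  have hda := fun v => (hd v).differentiableAt hp'
  have hz : ∀ u₁ u₂ : T, (∀ p ∈ ball (0 : T × Y) r, ∀ w : Y,
      fderiv ℂ A p (u₁, 0) * fderiv ℂ A p (0, w) -
        fderiv ℂ A p (0, w) * fderiv ℂ A p (u₁, 0) = 0) →
      fderiv ℂ (fun q => fderiv ℂ A q (u₁, 0) * fderiv ℂ A q (0, w) -
        fderiv ℂ A q (0, w) * fderiv ℂ A q (u₁, 0)) p (u₂, 0) = 0 := by
    intro u₁ u₂ h
    rw [Filter.EventuallyEq.fderiv_eq (f := fun _ => (0 : R))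
      (by filter_upwards [hp'] with q hq using h q hq w)]
    simp
  have h1 := hz u u' hCF
  have h2 := hz u' u hCF'
  rw [fderiv_commutator_apply (hda _) (hda _)] at h1 h2
  have hcomm := fun v v' => fderiv_fderiv_comm_of_holomorphic isOpen_ball hA hp v v'
  rw [fderiv_commutator_apply (hda _) (hda _), hcomm (u, 0) (0, w), hcomm (u', 0) (0, w)]
  rw [hcomm (u, 0) (u', 0)] at h1
  refine (norm_le_zero_iff.2 ?_).trans_eq (by simp)
  linear_combination (norm := noncomm_ring) h1 - h2

variable {Res : R}

/-- If `∂W = [W, ∂A]` holds in the `y`-directions, and in the direction `u` for `y = 0`, then it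
holds in the direction `u`. -/
theorem fderiv_eq_commutator (hA : DifferentiableOn ℂ A (ball 0 r))
    (hW : DifferentiableOn ℂ W (ball 0 r)) (u : T)
    (hCF : ∀ p ∈ ball (0 : T × Y) r, ∀ w : Y,
      fderiv ℂ A p (u, 0) * fderiv ℂ A p (0, w) - fderiv ℂ A p (0, w) * fderiv ℂ A p (u, 0) = 0)
    (hWy : ∀ p ∈ ball (0 : T × Y) r, ∀ w : Y,
      fderiv ℂ W p (0, w) = W p * fderiv ℂ A p (0, w) - fderiv ℂ A p (0, w) * W p)
    (h0 : ∀ t : T, (t, 0) ∈ ball (0 : T × Y) r →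
      fderiv ℂ W (t, 0) (u, 0) =
        W (t, 0) * fderiv ℂ A (t, 0) (u, 0) - fderiv ℂ A (t, 0) (u, 0) * W (t, 0)) :
    ∀ p ∈ ball (0 : T × Y) r,
      fderiv ℂ W p (u, 0) = W p * fderiv ℂ A p (u, 0) - fderiv ℂ A p (u, 0) * W p := by
  have hd := fun v => differentiableOn_fderiv_apply_of_holomorphic isOpen_ball hA v
  have hdW := fun v => differentiableOn_fderiv_apply_of_holomorphic isOpen_ball hW v
  suffices ∀ p ∈ ball (0 : T × Y) r, fderiv ℂ W p (u, 0) -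
      (W p * fderiv ℂ A p (u, 0) - fderiv ℂ A p (u, 0) * W p) = 0 from
    fun p hp => sub_eq_zero.1 (this p hp)
  refine eq_zero_of_norm_fderiv_le_mul_norm (a := fun q => 2 * ‖fderiv ℂ A q‖)
    ((hdW _).sub ((hW.mul (hd _)).sub ((hd _).mul hW)))
    (continuousOn_const.mul (continuousOn_fderiv_of_holomorphic isOpen_ball hA).norm)
    (fun p hp w => ?_) (fun t ht => sub_eq_zero.2 (h0 t ht))
  have hp' := isOpen_ball.mem_nhds hp
  have hda := fun v => (hd v).differentiableAt hp'
  have hdaW := fun v => (hdW v).differentiableAt hp'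
  have hWp := hW.differentiableAt hp'
  have h1 : fderiv ℂ (fun q => fderiv ℂ W q (0, w)) p (u, 0) =
      fderiv ℂ (fun q => W q * fderiv ℂ A q (0, w) - fderiv ℂ A q (0, w) * W q) p (u, 0) := by
    rw [Filter.EventuallyEq.fderiv_eq
      (by filter_upwards [hp'] with q hq using hWy q hq w)]
  rw [fderiv_commutator_apply hWp (hda _)] at h1
  have h2 := hCF p hp w
  have hF : ‖fderiv ℂ A p (0, w)‖ ≤ ‖fderiv ℂ A p‖ * ‖w‖ := by
    simpa using (fderiv ℂ A p).le_opNorm ((0 : T), w)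
  rw [fderiv_fun_sub (hdaW _) ((hWp.fun_mul (hda _)).fun_sub ((hda _).fun_mul hWp)),
    sub_apply, fderiv_commutator_apply hWp (hda _),
    fderiv_fderiv_comm_of_holomorphic isOpen_ball hW hp,
    fderiv_fderiv_comm_of_holomorphic isOpen_ball hA hp (u, 0), h1, hWy p hp w]
  set G := fderiv ℂ W p (u, 0) -
    (W p * fderiv ℂ A p (u, 0) - fderiv ℂ A p (u, 0) * W p) with hG
  have hEq : ∀ X : R, X = G * fderiv ℂ A p (0, w) - fderiv ℂ A p (0, w) * G →
      ‖X‖ ≤ 2 * ‖fderiv ℂ A p‖ * ‖w‖ * ‖G‖ := by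
    rintro _ rfl
    calc _ ≤ ‖G‖ * ‖fderiv ℂ A p (0, w)‖ + ‖fderiv ℂ A p (0, w)‖ * ‖G‖ :=
          (norm_sub_le _ _).trans (add_le_add (norm_mul_le _ _) (norm_mul_le _ _))
      _ = 2 * ‖fderiv ℂ A p (0, w)‖ * ‖G‖ := by ring
      _ ≤ 2 * (‖fderiv ℂ A p‖ * ‖w‖) * ‖G‖ := by gcongr
      _ = _ := by ring
  refine hEq _ ?_
  rw [hG]
  linear_combination (norm := noncomm_ring) W p * h2 - h2 * W p

/-- If `∂W = [W, ∂A]` holds in the directions `u` and `y`, and `∂U = [Res - W, ∂A] - ∂A` holds in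
the `y`-directions, and in the direction `u` for `y = 0`, then it holds in the direction `u`. -/
theorem fderiv_eq_commutator_sub (hA : DifferentiableOn ℂ A (ball 0 r))
    (hW : DifferentiableOn ℂ W (ball 0 r)) (hU : DifferentiableOn ℂ U (ball 0 r)) (u : T)
    (hCF : ∀ p ∈ ball (0 : T × Y) r, ∀ w : Y,
      fderiv ℂ A p (u, 0) * fderiv ℂ A p (0, w) - fderiv ℂ A p (0, w) * fderiv ℂ A p (u, 0) = 0)
    (hWy : ∀ p ∈ ball (0 : T × Y) r, ∀ w : Y,
      fderiv ℂ W p (0, w) = W p * fderiv ℂ A p (0, w) - fderiv ℂ A p (0, w) * W p)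
    (hWt : ∀ p ∈ ball (0 : T × Y) r,
      fderiv ℂ W p (u, 0) = W p * fderiv ℂ A p (u, 0) - fderiv ℂ A p (u, 0) * W p)
    (hUy : ∀ p ∈ ball (0 : T × Y) r, ∀ w : Y,
      fderiv ℂ U p (0, w) = (Res - W p) * fderiv ℂ A p (0, w) -
        fderiv ℂ A p (0, w) * (Res - W p) - fderiv ℂ A p (0, w))
    (h0 : ∀ t : T, (t, 0) ∈ ball (0 : T × Y) r →
      fderiv ℂ U (t, 0) (u, 0) = (Res - W (t, 0)) * fderiv ℂ A (t, 0) (u, 0) -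
        fderiv ℂ A (t, 0) (u, 0) * (Res - W (t, 0)) - fderiv ℂ A (t, 0) (u, 0)) :
    ∀ p ∈ ball (0 : T × Y) r,
      fderiv ℂ U p (u, 0) = (Res - W p) * fderiv ℂ A p (u, 0) -
        fderiv ℂ A p (u, 0) * (Res - W p) - fderiv ℂ A p (u, 0) := by
  have hd := fun v => differentiableOn_fderiv_apply_of_holomorphic isOpen_ball hA v
  have hdU := fun v => differentiableOn_fderiv_apply_of_holomorphic isOpen_ball hU v
  have hV : DifferentiableOn ℂ (fun q => Res - W q) (ball 0 r) := hW.const_sub Res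
  suffices ∀ p ∈ ball (0 : T × Y) r, fderiv ℂ U p (u, 0) -
      ((Res - W p) * fderiv ℂ A p (u, 0) -
        fderiv ℂ A p (u, 0) * (Res - W p) - fderiv ℂ A p (u, 0)) = 0 from
    fun p hp => sub_eq_zero.1 (this p hp)
  refine eq_zero_of_norm_fderiv_le_mul_norm (a := fun _ => 0)
    ((hdU _).sub (((hV.mul (hd _)).sub ((hd _).mul hV)).sub (hd _)))
    continuousOn_const (fun p hp w => ?_) (fun t ht => sub_eq_zero.2 (h0 t ht))
  have hp' := isOpen_ball.mem_nhds hp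
  have hda := fun v => (hd v).differentiableAt hp'
  have hdaU := fun v => (hdU v).differentiableAt hp'
  have hVp := hV.differentiableAt hp'
  have hdV : ∀ v, fderiv ℂ (fun q => Res - W q) p v = -fderiv ℂ W p v := by
    intro v
    rw [fderiv_const_sub]
    rfl
  have h1 : fderiv ℂ (fun q => fderiv ℂ U q (0, w)) p (u, 0) =
      fderiv ℂ (fun q => (Res - W q) * fderiv ℂ A q (0, w) -
        fderiv ℂ A q (0, w) * (Res - W q) - fderiv ℂ A q (0, w)) p (u, 0) := by
    rw [Filter.EventuallyEq.fderiv_eq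
      (by filter_upwards [hp'] with q hq using hUy q hq w)]
  rw [fderiv_fun_sub ((hVp.fun_mul (hda _)).fun_sub ((hda _).fun_mul hVp)) (hda _),
    sub_apply, fderiv_commutator_apply hVp (hda _), hdV, hWt p hp] at h1
  have h2 := hCF p hp w
  rw [fderiv_fun_sub (hdaU _) (((hVp.fun_mul (hda _)).fun_sub ((hda _).fun_mul hVp)).fun_sub (hda _)),
    sub_apply,
    fderiv_fun_sub ((hVp.fun_mul (hda _)).fun_sub ((hda _).fun_mul hVp)) (hda _),
    sub_apply, fderiv_commutator_apply hVp (hda _), hdV, hWy p hp,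
    fderiv_fderiv_comm_of_holomorphic isOpen_ball hU hp,
    fderiv_fderiv_comm_of_holomorphic isOpen_ball hA hp (u, 0), h1]
  refine (norm_le_zero_iff.2 ?_).trans_eq (by simp)
  linear_combination (norm := noncomm_ring) h2 * W p - W p * h2

/-- If `∂U = [Res - W, ∂A] - ∂A` holds in the directions `u` and `y`, and `U` commutes with the
`y`-derivatives of `A`, then `[∂A, U]` in the direction `u` vanishes as soon as it does for
`y = 0`. -/
theorem commutator_fderiv_potential_eq_zero (hA : DifferentiableOn ℂ A (ball 0 r))
    (hU : DifferentiableOn ℂ U (ball 0 r)) (u : T)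
    (hCF : ∀ p ∈ ball (0 : T × Y) r, ∀ w : Y,
      fderiv ℂ A p (u, 0) * fderiv ℂ A p (0, w) - fderiv ℂ A p (0, w) * fderiv ℂ A p (u, 0) = 0)
    (hFU : ∀ p ∈ ball (0 : T × Y) r, ∀ w : Y,
      fderiv ℂ A p (0, w) * U p - U p * fderiv ℂ A p (0, w) = 0)
    (hUy : ∀ p ∈ ball (0 : T × Y) r, ∀ w : Y,
      fderiv ℂ U p (0, w) = (Res - W p) * fderiv ℂ A p (0, w) -
        fderiv ℂ A p (0, w) * (Res - W p) - fderiv ℂ A p (0, w))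
    (hUt : ∀ p ∈ ball (0 : T × Y) r,
      fderiv ℂ U p (u, 0) = (Res - W p) * fderiv ℂ A p (u, 0) -
        fderiv ℂ A p (u, 0) * (Res - W p) - fderiv ℂ A p (u, 0))
    (h0 : ∀ t : T, (t, 0) ∈ ball (0 : T × Y) r →
      fderiv ℂ A (t, 0) (u, 0) * U (t, 0) - U (t, 0) * fderiv ℂ A (t, 0) (u, 0) = 0) :
    ∀ p ∈ ball (0 : T × Y) r, fderiv ℂ A p (u, 0) * U p - U p * fderiv ℂ A p (u, 0) = 0 := by
  have hd := fun v => differentiableOn_fderiv_apply_of_holomorphic isOpen_ball hA v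
  refine eq_zero_of_norm_fderiv_le_mul_norm (a := fun _ => 0)
    (((hd _).mul hU).sub (hU.mul (hd _))) continuousOn_const (fun p hp w => ?_) h0
  have hp' := isOpen_ball.mem_nhds hp
  have hda := fun v => (hd v).differentiableAt hp'
  have hUp := hU.differentiableAt hp'
  have h1 : fderiv ℂ (fun q => fderiv ℂ A q (0, w) * U q - U q * fderiv ℂ A q (0, w)) p (u, 0)
      = 0 := by
    rw [Filter.EventuallyEq.fderiv_eq (f := fun _ => (0 : R))
      (by filter_upwards [hp'] with q hq using hFU q hq w)]
    simp
  rw [fderiv_commutator_apply (hda _) hUp, hUt p hp] at h1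
  have h2 := hCF p hp w
  rw [fderiv_commutator_apply (hda _) hUp, hUy p hp,
    fderiv_fderiv_comm_of_holomorphic isOpen_ball hA hp (u, 0)]
  refine (norm_le_zero_iff.2 ?_).trans_eq (by simp)
  linear_combination (norm := noncomm_ring) h1 + (Res - W p) * h2 - h2 * (Res - W p) - 2 * h2

end Flatness

section Generation

variable {n : ℕ}

/-- Matrices commuting with a commuting family that has a cyclic vector commute. -/
theorem commute_of_genCond {r : ℕ} {B : Fin r → Mat n} {ζ : Fin n → ℂ} (hB : GenCond B ζ)
    (hcomm : ∀ i j, Commute (B i) (B j)) {X Y : Mat n} (hX : ∀ i, Commute X (B i))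
    (hY : ∀ i, Commute Y (B i)) : Commute X Y := by
  have hlist : ∀ {Z : Mat n}, (∀ i, Commute Z (B i)) → ∀ L : List (Fin r),
      Commute Z (L.map B).prod := fun hZ L =>
    Commute.list_prod_right _ _ fun x hx => by
      obtain ⟨i, -, rfl⟩ := List.mem_map.1 hx
      exact hZ i
  have hspan : ∀ v : Fin n → ℂ, ∃ P : Mat n, P.mulVec ζ = v ∧
      ∀ Z : Mat n, (∀ i, Commute Z (B i)) → Commute Z P := by
    intro v
    have hv : v ∈ Submodule.span ℂ
        {v : Fin n → ℂ | ∃ L : List (Fin r), v = Matrix.mulVec (L.map B).prod ζ} := by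
      rw [GenCond] at hB
      simp [hB]
    induction hv using Submodule.span_induction with
    | mem x hx =>
      obtain ⟨L, rfl⟩ := hx
      exact ⟨_, rfl, fun Z hZ => hlist hZ L⟩
    | zero => exact ⟨0, by simp, fun Z _ => Commute.zero_right Z⟩
    | add x y _ _ hx hy =>
      obtain ⟨P, rfl, hP⟩ := hx
      obtain ⟨Q, rfl, hQ⟩ := hy
      exact ⟨P + Q, Matrix.add_mulVec _ _ _, fun Z hZ => (hP Z hZ).add_right (hQ Z hZ)⟩
    | smul c x _ hx =>
      obtain ⟨P, rfl, hP⟩ := hx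
      exact ⟨c • P, Matrix.smul_mulVec _ _ _, fun Z hZ => (hP Z hZ).smul_right c⟩
  obtain ⟨P, hPζ, hP⟩ := hspan (X.mulVec ζ)
  have hPB : ∀ i, Commute P (B i) := fun i => (hP (B i) (hcomm i)).symm
  have hXP : X = P := by
    refine Matrix.ext_of_mulVec_single fun i => ?_
    obtain ⟨Q, hQ, hQc⟩ := hspan (Pi.single i 1)
    rw [← hQ, Matrix.mulVec_mulVec, Matrix.mulVec_mulVec, (hQc X hX).eq, (hQc P hPB).eq,
      ← Matrix.mulVec_mulVec, ← Matrix.mulVec_mulVec, hPζ]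
  rw [hXP]
  exact (hP Y hY).symm

/-- The generation condition is open. -/
theorem eventually_genCond {X : Type*} [TopologicalSpace X] {x₀ : X} {r : ℕ}
    {B : X → Fin r → Mat n} {ζ : Fin n → ℂ} (hcont : ∀ i, ContinuousAt (fun x => B x i) x₀)
    (hB : GenCond (B x₀) ζ) : ∀ᶠ x in nhds x₀, GenCond (B x) ζ := by
  obtain ⟨f, hfmem, -, hfli⟩ := Submodule.exists_fun_fin_finrank_span_eq ℂ
    {v : Fin n → ℂ | ∃ L : List (Fin r), v = Matrix.mulVec (L.map (B x₀)).prod ζ}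
  have hcard : Module.finrank ℂ (Submodule.span ℂ
      {v : Fin n → ℂ | ∃ L : List (Fin r), v = Matrix.mulVec (L.map (B x₀)).prod ζ}) = n := by
    rw [GenCond] at hB
    rw [hB, finrank_top, Module.finrank_fin_fun]
  choose L hL using hfmem
  let M : X → Matrix (Fin n) (Fin n) ℂ := fun x => Matrix.of fun k =>
    Matrix.mulVec ((L (Fin.cast hcard.symm k)).map (B x)).prod ζ
  have hprod : ∀ l : List (Fin r), ContinuousAt (fun x => (l.map (B x)).prod) x₀ := fun l =>
    tendsto_list_prod l fun i _ => hcont i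
  have hM : ContinuousAt M x₀ := by
    refine continuousAt_pi.2 fun k => ?_
    exact (Continuous.matrix_mulVec continuous_id continuous_const).continuousAt.comp (hprod _)
  have hdet : ContinuousAt (fun x => (M x).det) x₀ :=
    (Continuous.matrix_det continuous_id).continuousAt.comp hM
  have h0 : (M x₀).det ≠ 0 := by
    have hli : LinearIndependent ℂ (M x₀).row := by
      have : (M x₀).row = f ∘ Fin.cast hcard.symm := by
        funext k
        exact (hL _).symm
      rw [this]
      exact hfli.comp _ (Fin.cast_injective _)
    exact ((Matrix.isUnit_iff_isUnit_det _).1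
      (Matrix.linearIndependent_rows_iff_isUnit.1 hli)).ne_zero
  filter_upwards [hdet.eventually_ne h0] with x hx
  have hli := Matrix.linearIndependent_rows_iff_isUnit.2
    ((Matrix.isUnit_iff_isUnit_det _).2 (isUnit_iff_ne_zero.2 hx))
  rw [GenCond, eq_top_iff, ← hli.span_eq_top_of_card_eq_finrank' (by simp)]
  refine Submodule.span_mono ?_
  rintro _ ⟨k, rfl⟩
  exact ⟨_, rfl⟩

end Generation

section Transfer

variable {E : Type*} [NormedAddCommGroup E] [NormedSpace ℂ E] {n : ℕ}

attribute [local instance] Matrix.linftyOpNormedRing Matrix.linftyOpNormedAlgebra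

theorem MDiffOn.differentiableOn {f : E → Mat n} {s : Set E} (hf : MDiffOn f s) :
    DifferentiableOn ℂ f s := by
  have : f = fun q => ∑ i, ∑ j, f q i j • Matrix.single i j (1 : ℂ) := by
    funext q
    conv_lhs => rw [Matrix.matrix_eq_sum_single (f q)]
    simp [Matrix.smul_single]
  rw [this]
  exact DifferentiableOn.fun_sum fun i _ => DifferentiableOn.fun_sum fun j _ =>
    (hf i j).smul_const _

theorem mpderiv_eq_fderiv {f : E → Mat n} {p : E} (hf : DifferentiableAt ℂ f p) (v : E) :
    mpderiv f p v = fderiv ℂ f p v := by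
  ext k j
  let e : Mat n →L[ℂ] ℂ := LinearMap.toContinuousLinearMap (Matrix.entryLinearMap ℂ ℂ k j)
  have : HasFDerivAt (fun q => f q k j) (e.comp (fderiv ℂ f p)) p :=
    e.hasFDerivAt.comp p hf.hasFDerivAt
  simp only [mpderiv, Matrix.of_apply, this.fderiv]
  rfl

theorem fderiv_comp_fst_apply {T Y R : Type*} [NormedAddCommGroup T] [NormedSpace ℂ T]
    [NormedAddCommGroup Y] [NormedSpace ℂ Y] [NormedAddCommGroup R] [NormedSpace ℂ R]
    {g : T → R} {p : T × Y} (hg : DifferentiableAt ℂ g p.1) (w : Y) :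
    fderiv ℂ (fun q : T × Y => g q.1) p (0, w) = 0 := by
  have h : HasFDerivAt (fun q : T × Y => g q.1)
      ((fderiv ℂ g p.1).comp (ContinuousLinearMap.fst ℂ T Y)) p :=
    hg.hasFDerivAt.comp p hasFDerivAt_fst
  simp [h.fderiv]

theorem clm_apply_zero_prod_eq_sum {T R : Type*} [NormedAddCommGroup T]
    [NormedSpace ℂ T] [NormedAddCommGroup R] [NormedSpace ℂ R] {l : ℕ}
    (D : T × (Fin l → ℂ) →L[ℂ] R) (w : Fin l → ℂ) :
    D (0, w) = ∑ α, w α • D (0, Pi.single α 1) := by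
  have : ((0 : T), w) =
      ∑ α, w α • ((0 : T), (Pi.single α 1 : Fin l → ℂ)) := by
    ext x
    · simp [Prod.fst_sum]
    · simp [Prod.snd_sum, Finset.sum_apply, Pi.single_apply]
  rw [this, map_sum]
  exact Finset.sum_congr rfl fun α _ => map_smul D _ _

/-- The defining formula of `U` gives its `y`-derivatives. -/
theorem fderiv_potential_apply {T Y R : Type*} [NormedAddCommGroup T] [NormedSpace ℂ T]
    [NormedAddCommGroup Y] [NormedSpace ℂ Y] [NormedRing R] [NormedAlgebra ℂ R]
    {K : T → R} {A W : T × Y → R} {p : T × Y} (Res : R) (hK : DifferentiableAt ℂ K p.1)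
    (hA : DifferentiableAt ℂ A p) (hW : DifferentiableAt ℂ W p) (w : Y)
    (hWy : fderiv ℂ W p (0, w) = W p * fderiv ℂ A p (0, w) - fderiv ℂ A p (0, w) * W p) :
    fderiv ℂ (fun q => K q.1 - W q + (Res * A q - A q * Res) - A q) p (0, w) =
      (Res - W p) * fderiv ℂ A p (0, w) - fderiv ℂ A p (0, w) * (Res - W p)
        - fderiv ℂ A p (0, w) := by
  have hK' : DifferentiableAt ℂ (fun q : T × Y => K q.1) p := hK.comp p differentiableAt_fst
  have h := ((hK'.hasFDerivAt.fun_sub hW.hasFDerivAt).fun_add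
    ((hA.hasFDerivAt.const_mul Res).fun_sub (hA.hasFDerivAt.mul_const' Res))).fun_sub hA.hasFDerivAt
  rw [h.fderiv]
  simp only [sub_apply, add_apply, smul_apply,
    fderiv_comp_fst_apply hK, hWy, smul_eq_mul, op_smul_eq_mul]
  noncomm_ring

theorem stmt_4
    (n m l : ℕ) (hn : 0 < n) (hl : 0 < l)
    (N : Set (Pt m l)) (hNopen : IsOpen N) (hNconn : IsConnected N)
    (hN0 : (0 : Pt m l) ∈ N)
    (hNy0 : ∀ p : Pt m l, p ∈ N → ((p.1, 0) : Pt m l) ∈ N)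
    (A W : Pt m l → Mat n) (hAd : MDiffOn A N) (hWd : MDiffOn W N)
    (Res : Mat n)
    (U₀ : (Fin m → ℂ) → Mat n)
    (hU₀d : MDiffOn U₀ {t : Fin m → ℂ | ((t, 0) : Pt m l) ∈ N})
    -- the defined quantities C_i, F_α, V, U
    (C : Fin m → Pt m l → Mat n) (F : Fin l → Pt m l → Mat n)
    (U V : Pt m l → Mat n)
    (hCdef : ∀ i p, C i p = mpderiv A p (Pi.single i 1, 0))
    (hFdef : ∀ α p, F α p = mpderiv A p (0, Pi.single α 1))
    (hVdef : ∀ p, V p = Res - W p)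
    (hUdef : ∀ p : Pt m l,
      U p = U₀ p.1 - (W p - W (p.1, 0)) +
        matComm Res (A p - A (p.1, 0)) - (A p - A (p.1, 0)))
    -- (a) on all of N
    (ha1 : ∀ p ∈ N, ∀ i α, matComm (C i p) (F α p) = 0)
    (ha2 : ∀ p ∈ N, ∀ α, matComm (F α p) (U p) = 0)
    (ha3 : ∀ p ∈ N, ∀ α, mpderiv W p (0, Pi.single α 1) = matComm (W p) (F α p))
    -- (b) at y = 0
    (hb1 : ∀ t : Fin m → ℂ, ((t, 0) : Pt m l) ∈ N →
      ∀ i j, matComm (C i (t, 0)) (C j (t, 0)) = 0)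
    (hb2 : ∀ t : Fin m → ℂ, ((t, 0) : Pt m l) ∈ N →
      ∀ i, matComm (C i (t, 0)) (U (t, 0)) = 0)
    (hb3 : ∀ t : Fin m → ℂ, ((t, 0) : Pt m l) ∈ N →
      ∀ i, mpderiv U (t, 0) (Pi.single i 1, 0) =
        matComm (V (t, 0)) (C i (t, 0)) - C i (t, 0))
    (hb4 : ∀ t : Fin m → ℂ, ((t, 0) : Pt m l) ∈ N →
      ∀ i, mpderiv W (t, 0) (Pi.single i 1, 0) = matComm (W (t, 0)) (C i (t, 0)))
    -- (c) generation condition at the origin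
    (hGC : ∃ ζ : Fin n → ℂ,
      GenCond (Fin.snoc (fun i => C i 0) (U (0 : Pt m l))) ζ) :
    ∃ N' : Set (Pt m l), IsOpen N' ∧ (0 : Pt m l) ∈ N' ∧ N' ⊆ N ∧
      ∀ p ∈ N', FullSystemAt C F U V W p := by
  obtain ⟨ζ, hζ⟩ := hGC
  have hA := hAd.differentiableOn
  have hW := hWd.differentiableOn
  have hU₀ := hU₀d.differentiableOn
  have hdA := fun v => differentiableOn_fderiv_apply_of_holomorphic hNopen hA v
  have hCA : ∀ i, ∀ p ∈ N, C i p = fderiv ℂ A p (Pi.single i 1, 0) := fun i p hp => by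
    rw [hCdef, mpderiv_eq_fderiv (hA.differentiableAt (hNopen.mem_nhds hp))]
  have hFA : ∀ α, ∀ p ∈ N, F α p = fderiv ℂ A p (0, Pi.single α 1) := fun α p hp => by
    rw [hFdef, mpderiv_eq_fderiv (hA.differentiableAt (hNopen.mem_nhds hp))]
  let K : (Fin m → ℂ) → Mat n := fun t =>
    U₀ t + W (t, 0) - (Res * A (t, 0) - A (t, 0) * Res) + A (t, 0)
  have hslice : ∀ {f : Pt m l → Mat n}, DifferentiableOn ℂ f N →
      DifferentiableOn ℂ (fun t : Fin m → ℂ => f (t, 0)) {t | ((t, 0) : Pt m l) ∈ N} :=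
    fun hf => hf.comp (differentiableOn_id.prodMk (differentiableOn_const 0)) fun t ht => ht
  have hK : DifferentiableOn ℂ K {t | ((t, 0) : Pt m l) ∈ N} :=
    ((hU₀.add (hslice hW)).sub
      (((hslice hA).const_mul Res).sub ((hslice hA).mul_const Res))).add (hslice hA)
  have hSopen : IsOpen {t : Fin m → ℂ | ((t, 0) : Pt m l) ∈ N} :=
    hNopen.preimage (by fun_prop)
  have hUK : U = fun p => K p.1 - W p + (Res * A p - A p * Res) - A p := by
    funext p
    rw [hUdef, matComm]
    simp only [K]
    noncomm_ring
  have hU : DifferentiableOn ℂ U N := by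
    rw [hUK]
    exact (((hK.comp differentiableOn_fst fun p hp => hNy0 p hp).sub hW).add
      ((hA.const_mul Res).sub (hA.mul_const Res))).sub hA
  have hCdiff : ∀ i, DifferentiableOn ℂ (C i) N := fun i => (hdA _).congr (hCA i)
  have hFdiff : ∀ α, DifferentiableOn ℂ (F α) N := fun α => (hdA _).congr (hFA α)
  have hgen : ∀ᶠ p in nhds (0 : Pt m l),
      GenCond (Fin.snoc (fun i => C i p) (U p) : Fin (m + 1) → Mat n) ζ := by
    refine eventually_genCond (fun i => ?_) hζ
    refine Fin.lastCases ?_ (fun i => ?_) i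
    · simpa using (hU.differentiableAt (hNopen.mem_nhds hN0)).continuousAt
    · simpa using ((hCdiff i).differentiableAt (hNopen.mem_nhds hN0)).continuousAt
  obtain ⟨r, hr, hrN⟩ := Metric.mem_nhds_iff.1 (Filter.inter_mem (hNopen.mem_nhds hN0) hgen)
  have hsub : Metric.ball (0 : Pt m l) r ⊆ N := fun p hp => (hrN hp).1
  have hAr := hA.mono hsub
  have hWr := hW.mono hsub
  have hUr := hU.mono hsub
  have hsum : ∀ (f : Pt m l → Mat n) (p : Pt m l) (w : Fin l → ℂ),
      fderiv ℂ f p (0, w) = ∑ α, w α • fderiv ℂ f p (0, Pi.single α 1) :=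
    fun f p w => clm_apply_zero_prod_eq_sum (fderiv ℂ f p) w
  have hCF : ∀ i, ∀ p ∈ Metric.ball (0 : Pt m l) r, ∀ w : Fin l → ℂ,
      fderiv ℂ A p (Pi.single i 1, 0) * fderiv ℂ A p (0, w) -
        fderiv ℂ A p (0, w) * fderiv ℂ A p (Pi.single i 1, 0) = 0 := by
    intro i p hp w
    rw [hsum, Finset.mul_sum, Finset.sum_mul, ← Finset.sum_sub_distrib]
    refine Finset.sum_eq_zero fun α _ => ?_
    have := ha1 p (hsub hp) i α
    rw [matComm, hCA i p (hsub hp), hFA α p (hsub hp)] at this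
    rw [mul_smul_comm, smul_mul_assoc, ← smul_sub, this, smul_zero]
  have hFU : ∀ p ∈ Metric.ball (0 : Pt m l) r, ∀ w : Fin l → ℂ,
      fderiv ℂ A p (0, w) * U p - U p * fderiv ℂ A p (0, w) = 0 := by
    intro p hp w
    rw [hsum, Finset.mul_sum, Finset.sum_mul, ← Finset.sum_sub_distrib]
    refine Finset.sum_eq_zero fun α _ => ?_
    have := ha2 p (hsub hp) α
    rw [matComm, hFA α p (hsub hp)] at this
    rw [mul_smul_comm, smul_mul_assoc, ← smul_sub, this, smul_zero]
  have hWy : ∀ p ∈ Metric.ball (0 : Pt m l) r, ∀ w : Fin l → ℂ,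
      fderiv ℂ W p (0, w) = W p * fderiv ℂ A p (0, w) - fderiv ℂ A p (0, w) * W p := by
    intro p hp w
    rw [hsum W, hsum A, Finset.mul_sum,
      Finset.sum_mul, ← Finset.sum_sub_distrib]
    refine Finset.sum_congr rfl fun α _ => ?_
    have := ha3 p (hsub hp) α
    rw [matComm, hFA α p (hsub hp),
      mpderiv_eq_fderiv (hW.differentiableAt (hNopen.mem_nhds (hsub hp)))] at this
    rw [mul_smul_comm, smul_mul_assoc, ← smul_sub, this]
  have hUy : ∀ p ∈ Metric.ball (0 : Pt m l) r, ∀ w : Fin l → ℂ,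
      fderiv ℂ U p (0, w) = (Res - W p) * fderiv ℂ A p (0, w) -
        fderiv ℂ A p (0, w) * (Res - W p) - fderiv ℂ A p (0, w) := by
    intro p hp w
    have hp' := hNopen.mem_nhds (hsub hp)
    rw [hUK]
    exact fderiv_potential_apply Res
      (hK.differentiableAt (hSopen.mem_nhds (hNy0 p (hsub hp))))
      (hA.differentiableAt hp') (hW.differentiableAt hp') w (hWy p hp w)
  have hCC : ∀ i j, ∀ p ∈ Metric.ball (0 : Pt m l) r, _ := fun i j =>
    commutator_fderiv_eq_zero hAr (Pi.single i 1) (Pi.single j 1) (hCF i) (hCF j)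
      fun t ht => by
        have := hb1 t (hsub ht) i j
        rwa [matComm, hCA i _ (hsub ht), hCA j _ (hsub ht)] at this
  have hWt : ∀ i, ∀ p ∈ Metric.ball (0 : Pt m l) r, _ := fun i =>
    fderiv_eq_commutator hAr hWr (Pi.single i 1) (hCF i) hWy
      fun t ht => by
        have := hb4 t (hsub ht) i
        rwa [matComm, hCA i _ (hsub ht),
          mpderiv_eq_fderiv (hW.differentiableAt (hNopen.mem_nhds (hsub ht)))] at this
  have hUt : ∀ i, ∀ p ∈ Metric.ball (0 : Pt m l) r, _ := fun i =>
    fderiv_eq_commutator_sub hAr hWr hUr (Pi.single i 1) (hCF i) hWy (hWt i) hUy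
      fun t ht => by
        have := hb3 t (hsub ht) i
        rwa [matComm, hCA i _ (hsub ht), hVdef,
          mpderiv_eq_fderiv (hU.differentiableAt (hNopen.mem_nhds (hsub ht)))] at this
  have hCU : ∀ i, ∀ p ∈ Metric.ball (0 : Pt m l) r, _ := fun i =>
    commutator_fderiv_potential_eq_zero hAr hUr (Pi.single i 1) (hCF i) hFU hUy (hUt i)
      fun t ht => by
        have := hb2 t (hsub ht) i
        rwa [matComm, hCA i _ (hsub ht)] at this
  refine ⟨Metric.ball 0 r, Metric.isOpen_ball, Metric.mem_ball_self hr, hsub, fun p hp => ?_⟩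
  have hpN := hsub hp
  have hp' := hNopen.mem_nhds hpN
  have hdC : ∀ i v, mpderiv (C i) p v =
      fderiv ℂ (fun q => fderiv ℂ A q (Pi.single i 1, 0)) p v := fun i v => by
    rw [mpderiv_eq_fderiv ((hCdiff i).differentiableAt hp'), Filter.EventuallyEq.fderiv_eq
      (by filter_upwards [hp'] with q hq using hCA i q hq)]
  have hdF : ∀ α v, mpderiv (F α) p v =
      fderiv ℂ (fun q => fderiv ℂ A q (0, Pi.single α 1)) p v := fun α v => by
    rw [mpderiv_eq_fderiv ((hFdiff α).differentiableAt hp'), Filter.EventuallyEq.fderiv_eq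
      (by filter_upwards [hp'] with q hq using hFA α q hq)]
  have hdW : ∀ v, mpderiv W p v = fderiv ℂ W p v :=
    mpderiv_eq_fderiv (hW.differentiableAt hp')
  have hdU : ∀ v, mpderiv U p v = fderiv ℂ U p v :=
    mpderiv_eq_fderiv (hU.differentiableAt hp')
  have hdV : ∀ v, mpderiv V p v = -fderiv ℂ W p v := fun v => by
    rw [funext hVdef, mpderiv_eq_fderiv ((hW.differentiableAt hp').const_sub Res)]
    exact DFunLike.congr_fun (fderiv_const_sub Res) v
  have hCC' : ∀ i j, matComm (C i p) (C j p) = 0 := fun i j => by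
    rw [matComm, hCA i p hpN, hCA j p hpN]
    exact hCC i j p hp
  have hCU' : ∀ i, matComm (C i p) (U p) = 0 := fun i => by
    rw [matComm, hCA i p hpN]
    exact hCU i p hp
  have hFgen : ∀ α, ∀ i : Fin (m + 1),
      Commute (F α p) ((Fin.snoc (fun i => C i p) (U p) : Fin (m + 1) → Mat n) i) := by
    intro α i
    refine Fin.lastCases ?_ (fun i => ?_) i
    · simpa using show Commute _ _ from sub_eq_zero.1 (ha2 p hpN α)
    · simpa using show Commute _ _ from (sub_eq_zero.1 (ha1 p hpN i α)).symm
  refine ⟨hCC', ha1 p hpN, fun α β => ?_, fun i j => ?_, fun i α => ?_, fun α β => ?_, hCU',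
    ha2 p hpN, fun i => ?_, fun α => ?_, fun i => ?_, fun α => ?_, fun i => ?_, fun α => ?_⟩
  · refine sub_eq_zero.2 (commute_of_genCond (hrN hp).2 (fun i j => ?_) (hFgen α) (hFgen β)).eq
    refine Fin.lastCases (Fin.lastCases ?_ (fun j => ?_) j)
      (fun i => Fin.lastCases ?_ (fun j => ?_) j) i
    · simp
    · simpa using show Commute _ _ from (sub_eq_zero.1 (hCU' j)).symm
    · simpa using show Commute _ _ from sub_eq_zero.1 (hCU' i)
    · simpa using show Commute _ _ from sub_eq_zero.1 (hCC' i j)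
  · rw [hdC, hdC]
    exact fderiv_fderiv_comm_of_holomorphic hNopen hA hpN _ _
  · rw [hdC, hdF]
    exact fderiv_fderiv_comm_of_holomorphic hNopen hA hpN _ _
  · rw [hdF, hdF]
    exact fderiv_fderiv_comm_of_holomorphic hNopen hA hpN _ _
  · rw [hdU, matComm, hVdef, hCA i p hpN]
    exact hUt i p hp
  · rw [hdU, matComm, hVdef, hFA α p hpN, hUy p hp]
  · rw [hdW, matComm, hCA i p hpN]
    exact hWt i p hp
  · rw [hdW, matComm, hFA α p hpN, hWy p hp]
  · rw [hdV, matComm, hCA i p hpN]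
    exact congrArg Neg.neg (hWt i p hp)
  · rw [hdV, matComm, hFA α p hpN, hWy p hp]

end Transfer
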